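/- arXiv:2503.09558 — 3 statements merged into one kernel-verified Lean document; each statement's English description precedes it below -/
import Mathlib

section
/- Dodgson representation of the Pfaffian form. Let G be a connected graph with even loop number ℓ and let 𝒞 be a cycle incidence matrix of G. Then φ_G = ((−π)^{ℓ/2} 2^ℓ (ℓ/2)! ψ_G^{(ℓ+1)/2})^{−1} · ∑_{T spanning tree} (−1)^{k_1+⋯+k_ℓ} det(𝒞[E∖T]) (∑_σ ψ^{σ(f_1),σ(f_2)} ⋯ ψ^{σ(f_{ℓ−1}),σ(f_ℓ)}) θ_{f_1} ∧ ⋯ ∧ θ_{f_ℓ}, where for each spanning tree T the complement is E ∖ T = {f_1 < ... < f_ℓ} with f_i = e_{k_i}, σ ranges over all permutations of {f_1, ..., f_ℓ}, and ψ_G^{(ℓ+1)/2} is the positive real power. -/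
open Matrix BigOperators

namespace GraphForms

/-- Vertices `x` and `y` are connected using only edges in `T` (in either direction). -/
def Conn (m n : ℕ) (s t : Fin m → Fin n) (T : Set (Fin m)) (x y : Fin n) : Prop :=
  Relation.ReflTransGen
    (fun a b => ∃ e ∈ T, (s e = a ∧ t e = b) ∨ (s e = b ∧ t e = a)) x y

/-- The graph is connected. -/
def IsConnectedGraph (m n : ℕ) (s t : Fin m → Fin n) : Prop :=
  ∀ x y, Conn m n s t Set.univ x y

/-- `T ⊆ E` is a spanning tree: it has `n - 1` edges and connects all vertices. -/
def IsSpanningTree (m n : ℕ) (s t : Fin m → Fin n) (T : Finset (Fin m)) : Prop :=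
  T.card = n - 1 ∧ ∀ x y, Conn m n s t ↑T x y

/-- The reduced vertex incidence matrix `𝕀` (the distinguished vertex is the last one). -/
def inc (R : Type*) [Ring R] (m n' : ℕ) (s t : Fin m → Fin (n' + 1)) :
    Matrix (Fin m) (Fin n') R :=
  Matrix.of fun e j =>
    (if t e = Fin.castSucc j then (1 : R) else 0) -
      (if s e = Fin.castSucc j then (1 : R) else 0)

/-- `C` is a cycle incidence matrix: its columns lie in, and form a `ℤ`-basis of,
the lattice `{x : ℤ^E | 𝕀ᵀ x = 0}`. -/
def IsCycleMatrix (m n' ℓ : ℕ) (s t : Fin m → Fin (n' + 1))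
    (C : Matrix (Fin m) (Fin ℓ) ℤ) : Prop :=
  (inc ℤ m n' s t)ᵀ * C = 0 ∧
    ∀ x : Fin m → ℤ, (inc ℤ m n' s t)ᵀ.mulVec x = 0 →
      ∃! c : Fin ℓ → ℤ, C.mulVec c = x

/-- The concatenation `[X|Y]` of the columns of `X` and of `Y`, a square matrix. -/
def concat {R : Type*} {m ℓ c : ℕ} (h : ℓ + c = m) (X : Matrix (Fin m) (Fin ℓ) R)
    (Y : Matrix (Fin m) (Fin c) R) : Matrix (Fin m) (Fin m) R :=
  Matrix.of fun i j => Sum.elim (X i) (Y i) (finSumFinEquiv.symm (Fin.cast h.symm j))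

/-- The row submatrix `X[S]` (rows of `S` taken in increasing order);
junk value `0` if `S.card ≠ k`. -/
noncomputable def rowSub {R : Type*} [Zero R] {m c : ℕ} (X : Matrix (Fin m) (Fin c) R)
    (S : Finset (Fin m)) (k : ℕ) : Matrix (Fin k) (Fin c) R :=
  if h : S.card = k then Matrix.of fun i j => X ((S.orderIsoOfFin h) i : Fin m) j else 0

/-- The expanded vertex Laplacian `𝕄`, rows/columns indexed by edges and then vertices. -/
def MM (m n' : ℕ) (s t : Fin m → Fin (n' + 1)) (a : Fin m → ℝ) :
    Matrix (Fin (m + n')) (Fin (m + n')) ℝ :=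
  Matrix.of fun i j =>
    Matrix.fromBlocks (Matrix.diagonal a) (inc ℝ m n' s t) (-(inc ℝ m n' s t)ᵀ) 0
      (finSumFinEquiv.symm i) (finSumFinEquiv.symm j)

/-- The Symanzik polynomial `ψ_G = det 𝕄`. -/
noncomputable def psi (m n' : ℕ) (s t : Fin m → Fin (n' + 1)) (a : Fin m → ℝ) : ℝ :=
  (MM m n' s t a).det

/-- The Dodgson polynomial `ψ^{A,B}`: delete the rows in `A` and the columns in `B`
from `𝕄` (keeping the induced order) and take the determinant. -/
noncomputable def dodgson (m n' : ℕ) (s t : Fin m → Fin (n' + 1)) (a : Fin m → ℝ)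
    (A B : Finset (Fin (m + n'))) : ℝ :=
  if h : A.card = B.card then
    Matrix.det (Matrix.of fun i j : Fin (m + n' - A.card) =>
      MM m n' s t a
        ((Aᶜ.orderIsoOfFin (by simp [Finset.card_compl]) i : Fin (m + n')))
        ((Bᶜ.orderIsoOfFin (by simp [Finset.card_compl, h]) j : Fin (m + n'))))
  else 0

/-- Index of the edge `i` among the rows/columns of `𝕄`. -/
def edgeIdx (m n' : ℕ) (i : Fin m) : Fin (m + n') := Fin.castAdd n' i

/-- Index of the vertex `j` among the rows/columns of `𝕄`. -/
def vtxIdx (m n' : ℕ) (j : Fin n') : Fin (m + n') := Fin.natAdd m j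

/-- The edge Dodgson polynomial `ψ^{e_i,e_j}`. -/
noncomputable def dodgE (m n' : ℕ) (s t : Fin m → Fin (n' + 1)) (a : Fin m → ℝ)
    (i j : Fin m) : ℝ :=
  dodgson m n' s t a {edgeIdx m n' i} {edgeIdx m n' j}

/-- The vertex Dodgson polynomial `ψ^{v_i,v_j}`. -/
noncomputable def dodgV (m n' : ℕ) (s t : Fin m → Fin (n' + 1)) (a : Fin m → ℝ)
    (i j : Fin n') : ℝ :=
  dodgson m n' s t a {vtxIdx m n' i} {vtxIdx m n' j}

/-- The vertex Laplacian `L = 𝕀ᵀ D⁻¹ 𝕀`. -/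
noncomputable def vertexLap (m n' : ℕ) (s t : Fin m → Fin (n' + 1)) (a : Fin m → ℝ) :
    Matrix (Fin n') (Fin n') ℝ :=
  (inc ℝ m n' s t)ᵀ * Matrix.diagonal (fun i => (a i)⁻¹) * inc ℝ m n' s t

/-- The cycle Laplacian `Λ = 𝒞ᵀ D 𝒞`. -/
def cycleLap {m ℓ : ℕ} (a : Fin m → ℝ) (C : Matrix (Fin m) (Fin ℓ) ℤ) :
    Matrix (Fin ℓ) (Fin ℓ) ℝ :=
  (C.map (Int.cast : ℤ → ℝ))ᵀ * Matrix.diagonal a * C.map (Int.cast : ℤ → ℝ)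

/-- The degree-one generators `θ_i` of the exterior algebra `Ω`. -/
noncomputable def θ (m : ℕ) (i : Fin m) : ExteriorAlgebra ℝ (Fin m → ℝ) :=
  ExteriorAlgebra.ι ℝ (Pi.single i 1)

/-- The Pfaffian of a `2k × 2k` matrix with entries in the exterior algebra. -/
noncomputable def pfaffian {m N k : ℕ} (hk : N = 2 * k)
    (X : Matrix (Fin N) (Fin N) (ExteriorAlgebra ℝ (Fin m → ℝ))) :
    ExteriorAlgebra ℝ (Fin m → ℝ) :=
  ((2 ^ k * (Nat.factorial k : ℝ))⁻¹) •
    ∑ σ : Equiv.Perm (Fin N), (((Equiv.Perm.sign σ : ℤ) : ℝ)) •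
      (List.ofFn fun i : Fin k =>
        X (σ (Fin.cast hk.symm ⟨2 * i.1, by have := i.2; omega⟩))
          (σ (Fin.cast hk.symm ⟨2 * i.1 + 1, by have := i.2; omega⟩))).prod

/-- `dΛ = 𝒞ᵀ Θ 𝒞`, with `Θ = diag(θ_1, ..., θ_m)`, in the exterior algebra. -/
noncomputable def dLam {m ℓ : ℕ} (C : Matrix (Fin m) (Fin ℓ) ℤ) :
    Matrix (Fin ℓ) (Fin ℓ) (ExteriorAlgebra ℝ (Fin m → ℝ)) :=
  (C.map fun z => algebraMap ℝ (ExteriorAlgebra ℝ (Fin m → ℝ)) (z : ℝ))ᵀ *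
    Matrix.diagonal (θ m) *
    C.map fun z => algebraMap ℝ (ExteriorAlgebra ℝ (Fin m → ℝ)) (z : ℝ)

/-- The Pfaffian form `φ_G = (−2π)^{−ℓ/2} Pf(dΛ Λ⁻¹ dΛ) / √ψ_G`. -/
noncomputable def phiForm (m n' ℓ k : ℕ) (hk : ℓ = 2 * k)
    (s t : Fin m → Fin (n' + 1)) (a : Fin m → ℝ) (C : Matrix (Fin m) (Fin ℓ) ℤ) :
    ExteriorAlgebra ℝ (Fin m → ℝ) :=
  ((((-2) * Real.pi) ^ k)⁻¹ * (Real.sqrt (psi m n' s t a))⁻¹) •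
    pfaffian hk
      (dLam C * ((cycleLap a C)⁻¹).map (algebraMap ℝ (ExteriorAlgebra ℝ (Fin m → ℝ))) *
        dLam C)

open Classical in
/-- Sum of `F T` over all spanning trees `T` of the graph. -/
noncomputable def treeSum {β : Type*} [AddCommMonoid β] (m n' : ℕ)
    (s t : Fin m → Fin (n' + 1)) (F : Finset (Fin m) → β) : β :=
  ∑ T ∈ Finset.univ.filter (fun T : Finset (Fin m) => IsSpanningTree m (n' + 1) s t T), F T

open Classical in
/-- The number of spanning trees of the graph. -/
noncomputable def treeCount (m n' : ℕ) (s t : Fin m → Fin (n' + 1)) : ℕ :=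
  (Finset.univ.filter (fun T : Finset (Fin m) => IsSpanningTree m (n' + 1) s t T)).card

/-- The summand of `α_G` corresponding to a spanning tree `T`. -/
noncomputable def alphaTerm {m n' ℓ k : ℕ} (hk : ℓ = 2 * k)
    (s t : Fin m → Fin (n' + 1)) (a : Fin m → ℝ) (T : Finset (Fin m)) :
    ExteriorAlgebra ℝ (Fin m → ℝ) :=
  if h : Tᶜ.card = ℓ then
    ((rowSub (inc ℝ m n' s t) T n').det *
        ∑ σ : Equiv.Perm (Fin ℓ), ∏ i : Fin k,
          dodgE m n' s t a
            ((Tᶜ.orderIsoOfFin h) (σ (Fin.cast hk.symm ⟨2 * i.1, by have := i.2; omega⟩)) : Fin m)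
            ((Tᶜ.orderIsoOfFin h) (σ (Fin.cast hk.symm ⟨2 * i.1 + 1, by have := i.2; omega⟩)) : Fin m)) •
      (List.ofFn fun j : Fin ℓ => θ m ((Tᶜ.orderIsoOfFin h) j : Fin m)).prod
  else 0

/-- The topological form `α_G`. -/
noncomputable def alphaForm (m n' ℓ k : ℕ) (hk : ℓ = 2 * k)
    (s t : Fin m → Fin (n' + 1)) (a : Fin m → ℝ) :
    ExteriorAlgebra ℝ (Fin m → ℝ) :=
  ((Real.pi ^ k * 4 ^ ℓ * (Nat.factorial k : ℝ) *
      psi m n' s t a ^ (((ℓ : ℝ) + 1) / 2))⁻¹) •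
    treeSum m n' s t (alphaTerm hk s t a)

/-- A walk in the graph, with signed edge traversals. -/
structure GWalk (m n : ℕ) (s t : Fin m → Fin n) (k : ℕ) where
  g : Fin k → Fin m
  ε : Fin k → ℤ
  u : Fin (k + 1) → Fin n
  hε : ∀ i, ε i = 1 ∨ ε i = -1
  hstep : ∀ i : Fin k,
    (ε i = 1 → s (g i) = u i.castSucc ∧ t (g i) = u i.succ) ∧
    (ε i = -1 → s (g i) = u i.succ ∧ t (g i) = u i.castSucc)

/-- The signed incidence vector of a walk. -/
def GWalk.vec {m n k : ℕ} {s t : Fin m → Fin n} (W : GWalk m n s t k) : Fin m → ℤ :=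
  fun e => ∑ i : Fin k, if W.g i = e then W.ε i else 0

/-- The lift of a vector along the subdivision of the edge `k` into two edges. -/
def liftVec {m : ℕ} (k : Fin m) (x : Fin m → ℤ) : Fin (m + 1) → ℤ :=
  fun i => if _ : i.1 ≤ k.1 then x ⟨i.1, by have := k.2; omega⟩
    else x ⟨i.1 - 1, by have := i.2; omega⟩


theorem adjugate_eq_det_compl {N : ℕ} (A : Matrix (Fin N) (Fin N) ℝ) (i j : Fin N)
    (hj : (({j} : Finset (Fin N))ᶜ).card = N - ({j} : Finset (Fin N)).card)
    (hi : (({i} : Finset (Fin N))ᶜ).card = N - ({j} : Finset (Fin N)).card) :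
    A.adjugate i j = (-1) ^ (j + i : ℕ) *
      Matrix.det (Matrix.of fun p q : Fin (N - ({j} : Finset (Fin N)).card) =>
        A ((({j} : Finset (Fin N))ᶜ.orderIsoOfFin hj p : Fin N))
          ((({i} : Finset (Fin N))ᶜ.orderIsoOfFin hi q : Fin N))) := by
  cases N with
  | zero => exact i.elim0
  | succ N =>
    rw [adjugate_fin_succ_eq_det_submatrix]
    congr 1
    have key : ∀ (x : Fin (N + 1)) (h : (({x} : Finset (Fin (N + 1)))ᶜ).card = N) (p : Fin N),
        ((({x} : Finset (Fin (N + 1)))ᶜ.orderIsoOfFin h p : Fin (N + 1))) = x.succAbove p := by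
      intro x h p
      rw [Finset.coe_orderIsoOfFin_apply, Finset.orderEmbOfFin_compl_singleton_apply]
      rfl
    refine congrArg Matrix.det (Matrix.ext fun p q => ?_)
    exact (congrArg₂ A (key j hj p) (key i hi q)).symm

theorem adjugate_MM_edge {m n' : ℕ} (s t : Fin m → Fin (n' + 1)) (a : Fin m → ℝ) (e f : Fin m) :
    (MM m n' s t a).adjugate (edgeIdx m n' f) (edgeIdx m n' e) =
      (-1) ^ ((e : ℕ) + f) * dodgE m n' s t a e f := by
  rw [dodgE, dodgson, dif_pos (by simp), adjugate_eq_det_compl]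
  rfl

/-- Extension of a function on the non-distinguished vertices by `0`. -/
def extendZero {R : Type*} [Zero R] {n' : ℕ} (y : Fin n' → R) : Fin (n' + 1) → R :=
  Fin.snoc (α := fun _ => R) y 0

theorem inc_mulVec {R : Type*} [Ring R] {m n' : ℕ} (s t : Fin m → Fin (n' + 1)) (y : Fin n' → R)
    (e : Fin m) :
    (inc R m n' s t).mulVec y e = extendZero y (t e) - extendZero y (s e) := by
  have h (v : Fin (n' + 1)) :
      ∑ j, (if v = Fin.castSucc j then (1 : R) else 0) * y j = extendZero y v := by
    refine Fin.lastCases ?_ (fun i => ?_) v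
    · simp [extendZero, (Fin.castSucc_lt_last _).ne']
    · simp [extendZero]
  simp only [mulVec, dotProduct, inc, of_apply, sub_mul, Finset.sum_sub_distrib, h]

theorem extendZero_eq_of_conn {R : Type*} [Ring R] {m n' : ℕ} {s t : Fin m → Fin (n' + 1)}
    {y : Fin n' → R} {T : Set (Fin m)} (hy : ∀ e ∈ T, (inc R m n' s t).mulVec y e = 0)
    {u v : Fin (n' + 1)} (h : Conn m (n' + 1) s t T u v) : extendZero y u = extendZero y v := by
  induction h with
  | refl => rfl
  | tail _ hbc ih =>
    obtain ⟨e, he, h⟩ := hbc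
    have := hy e he
    rw [inc_mulVec, sub_eq_zero] at this
    rcases h with ⟨rfl, rfl⟩ | ⟨rfl, rfl⟩
    · rw [ih, this]
    · rw [ih, this]

theorem inc_mulVec_eq_zero {R : Type*} [Ring R] {m n' : ℕ} {s t : Fin m → Fin (n' + 1)}
    (hconn : IsConnectedGraph m (n' + 1) s t) {y : Fin n' → R}
    (hy : (inc R m n' s t).mulVec y = 0) : y = 0 := by
  funext j
  have := extendZero_eq_of_conn (T := Set.univ) (y := y) (fun e _ => congrFun hy e)
    (hconn (Fin.castSucc j) (Fin.last n'))
  simpa [extendZero] using this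

theorem inc_mulVec_injective {R : Type*} [Ring R] {m n' : ℕ} {s t : Fin m → Fin (n' + 1)}
    (hconn : IsConnectedGraph m (n' + 1) s t) :
    Function.Injective (inc R m n' s t).mulVec := by
  intro x y h
  exact sub_eq_zero.1 (inc_mulVec_eq_zero hconn (by rw [mulVec_sub, h, sub_self]))

theorem posDef_transpose_diagonal_mul {m n : ℕ} {a : Fin m → ℝ} (ha : ∀ i, 0 < a i)
    {B : Matrix (Fin m) (Fin n) ℝ} (hB : Function.Injective B.mulVec) :
    (Bᵀ * Matrix.diagonal a * B).PosDef := by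
  have := (Matrix.PosDef.diagonal ha).conjTranspose_mul_mul_same hB
  rwa [conjTranspose_eq_transpose_of_trivial] at this

theorem posDef_vertexLap {m n' : ℕ} {s t : Fin m → Fin (n' + 1)}
    (hconn : IsConnectedGraph m (n' + 1) s t) {a : Fin m → ℝ} (ha : ∀ i, 0 < a i) :
    (vertexLap m n' s t a).PosDef :=
  posDef_transpose_diagonal_mul (fun i => inv_pos.2 (ha i)) (inc_mulVec_injective hconn)

theorem map_intCast_mulVec_injective {m ℓ : ℕ} {C : Matrix (Fin m) (Fin ℓ) ℤ}
    (hC : ∀ c, C.mulVec c = 0 → c = 0) :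
    Function.Injective (C.map (Int.cast : ℤ → ℝ)).mulVec := by
  have hdet : (Cᵀ * C).det ≠ 0 := by
    intro h
    obtain ⟨v, hv, h⟩ := Matrix.exists_mulVec_eq_zero_iff.2 h
    refine hv (hC v (dotProduct_self_eq_zero.1 ?_))
    rw [Matrix.dotProduct_mulVec, ← Matrix.mulVec_transpose, Matrix.mulVec_mulVec, h,
      zero_dotProduct]
  have hdet' : ((C.map (Int.cast : ℤ → ℝ))ᵀ * C.map (Int.cast : ℤ → ℝ)).det ≠ 0 := by
    have h : (C.map (Int.cast : ℤ → ℝ))ᵀ * C.map (Int.cast : ℤ → ℝ) =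
        (Int.castRingHom ℝ).mapMatrix (Cᵀ * C) := by
      rw [RingHom.mapMatrix_apply, Matrix.map_mul]; rfl
    rw [h, ← RingHom.map_det]
    simpa using hdet
  intro x y h
  have h0 : (C.map (Int.cast : ℤ → ℝ)).mulVec (x - y) = 0 := by rw [mulVec_sub, h, sub_self]
  refine sub_eq_zero.1 (by_contra fun hxy => hdet' (Matrix.exists_mulVec_eq_zero_iff.1
    ⟨x - y, hxy, ?_⟩))
  rw [← Matrix.mulVec_mulVec, h0, mulVec_zero]

theorem IsCycleMatrix.mulVec_injective {m n' ℓ : ℕ} {s t : Fin m → Fin (n' + 1)}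
    {C : Matrix (Fin m) (Fin ℓ) ℤ} (hC : IsCycleMatrix m n' ℓ s t C) :
    Function.Injective (C.map (Int.cast : ℤ → ℝ)).mulVec :=
  map_intCast_mulVec_injective fun _ hc =>
    (hC.2 0 (mulVec_zero _)).unique hc (mulVec_zero _)

theorem map_inc {m n' : ℕ} (s t : Fin m → Fin (n' + 1)) :
    (inc ℤ m n' s t).map (Int.cast : ℤ → ℝ) = inc ℝ m n' s t := by
  ext i j
  simp [inc]

theorem IsCycleMatrix.transpose_mul_inc {m n' ℓ : ℕ} {s t : Fin m → Fin (n' + 1)}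
    {C : Matrix (Fin m) (Fin ℓ) ℤ} (hC : IsCycleMatrix m n' ℓ s t C) :
    (C.map (Int.cast : ℤ → ℝ))ᵀ * inc ℝ m n' s t = 0 := by
  have h1 : Cᵀ * inc ℤ m n' s t = 0 := by
    rw [← Matrix.transpose_inj, transpose_mul, transpose_transpose, hC.1, transpose_zero]
  rw [← map_inc, ← transpose_map]
  have := congrArg (fun M => M.map (Int.castRingHom ℝ)) h1
  rw [Matrix.map_mul] at this
  simpa using! this

/-- The completeness relation for the splitting of edge space into cycles and cuts. -/
theorem cycle_add_cut {m n' ℓ : ℕ} {s t : Fin m → Fin (n' + 1)}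
    (hconn : IsConnectedGraph m (n' + 1) s t) (hm : ℓ + n' = m) {a : Fin m → ℝ}
    (ha : ∀ i, 0 < a i) {C : Matrix (Fin m) (Fin ℓ) ℤ} (hC : IsCycleMatrix m n' ℓ s t C) :
    C.map (Int.cast : ℤ → ℝ) * (cycleLap a C)⁻¹ * (C.map (Int.cast : ℤ → ℝ))ᵀ =
      diagonal (fun i => (a i)⁻¹) - diagonal (fun i => (a i)⁻¹) * inc ℝ m n' s t *
        (vertexLap m n' s t a)⁻¹ * (inc ℝ m n' s t)ᵀ * diagonal (fun i => (a i)⁻¹) := by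
  set B := C.map (Int.cast : ℤ → ℝ) with hB
  set I := inc ℝ m n' s t with hI
  set D := diagonal a with hD
  set D' := diagonal (fun i => (a i)⁻¹) with hD'
  have hDD' : D * D' = 1 := by
    simp [hD, hD', (ha _).ne']
  have hΛ : (cycleLap a C)⁻¹ * (Bᵀ * D * B) = 1 :=
    Matrix.nonsing_inv_mul _
      (posDef_transpose_diagonal_mul ha hC.mulVec_injective).det_pos.ne'.isUnit
  have hL : (vertexLap m n' s t a)⁻¹ * (Iᵀ * D' * I) = 1 :=
    Matrix.nonsing_inv_mul _ (posDef_vertexLap hconn ha).det_pos.ne'.isUnit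
  have hBI : Bᵀ * I = 0 := hC.transpose_mul_inc
  have hIB : Iᵀ * B = 0 := by
    rw [← Matrix.transpose_inj, transpose_mul, transpose_transpose, hBI, transpose_zero]
  have h1 : fromRows ((cycleLap a C)⁻¹ * Bᵀ * D) ((vertexLap m n' s t a)⁻¹ * Iᵀ) *
      fromCols B (D' * I) = 1 := by
    rw [fromRows_mul_fromCols, ← fromBlocks_one]
    congr 1
    · rw [← hΛ]; simp only [Matrix.mul_assoc]
    · rw [Matrix.mul_assoc, ← Matrix.mul_assoc D, hDD', Matrix.one_mul, Matrix.mul_assoc, hBI,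
        Matrix.mul_zero]
    · rw [Matrix.mul_assoc, hIB, Matrix.mul_zero]
    · rw [← hL]; simp only [Matrix.mul_assoc]
  replace h1 := (Matrix.mul_eq_one_comm_of_card_eq _ _ _ (by simp [hm])).1 h1
  rw [fromCols_mul_fromRows] at h1
  have h2 := congrArg (· * D') h1
  simp only [Matrix.add_mul, Matrix.one_mul] at h2
  rw [eq_sub_iff_add_eq]
  refine Eq.trans ?_ h2
  simp only [Matrix.mul_assoc, hDD', Matrix.mul_one]

theorem psi_pos {m n' : ℕ} {s t : Fin m → Fin (n' + 1)}
    (hconn : IsConnectedGraph m (n' + 1) s t) {a : Fin m → ℝ} (ha : ∀ i, 0 < a i) :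
    0 < psi m n' s t a := by
  have h : MM m n' s t a = (fromBlocks (diagonal a) (inc ℝ m n' s t) (-(inc ℝ m n' s t)ᵀ)
      0).submatrix finSumFinEquiv.symm finSumFinEquiv.symm := rfl
  have : Invertible (diagonal a) := by
    refine ⟨diagonal fun i => (a i)⁻¹, ?_, ?_⟩ <;> simp [(ha _).ne']
  have hinv : ⅟(diagonal a) = diagonal fun i => (a i)⁻¹ :=
    invOf_eq_right_inv (by simp [(ha _).ne'])
  rw [psi, h, det_submatrix_equiv_self, det_fromBlocks₁₁, hinv]
  refine mul_pos ?_ ?_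
  · rw [det_diagonal]
    exact Finset.prod_pos fun i _ => ha i
  · have := (posDef_vertexLap hconn ha).det_pos
    simpa [vertexLap] using this

theorem cycle_propagator_eq_dodgE {m n' ℓ : ℕ} {s t : Fin m → Fin (n' + 1)}
    (hconn : IsConnectedGraph m (n' + 1) s t) (hm : ℓ + n' = m) {a : Fin m → ℝ}
    (ha : ∀ i, 0 < a i) {C : Matrix (Fin m) (Fin ℓ) ℤ} (hC : IsCycleMatrix m n' ℓ s t C)
    (e f : Fin m) :
    (C.map (Int.cast : ℤ → ℝ) * (cycleLap a C)⁻¹ * (C.map (Int.cast : ℤ → ℝ))ᵀ) e f =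
      (-1) ^ ((e : ℕ) + f) * dodgE m n' s t a e f * (psi m n' s t a)⁻¹ := by
  set I := inc ℝ m n' s t with hI
  set D := diagonal a with hD
  set D' := diagonal (fun i => (a i)⁻¹) with hD'
  set P := C.map (Int.cast : ℤ → ℝ) * (cycleLap a C)⁻¹ * (C.map (Int.cast : ℤ → ℝ))ᵀ with hP
  set L := vertexLap m n' s t a with hL
  have hDD' : D * D' = 1 := by
    simp [hD, hD', (ha _).ne']
  have hLI : Iᵀ * D' * I * L⁻¹ = 1 :=
    Matrix.mul_nonsing_inv _ (posDef_vertexLap hconn ha).det_pos.ne'.isUnit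
  have hP' : P = D' - D' * I * L⁻¹ * Iᵀ * D' := cycle_add_cut hconn hm ha hC
  have hPsymm : Pᵀ = P := by
    have : (cycleLap a C)ᵀ = cycleLap a C := by
      simp [cycleLap, Matrix.mul_assoc]
    rw [hP]
    simp only [transpose_mul, transpose_transpose, transpose_nonsing_inv, this, Matrix.mul_assoc]
  have h1 : fromBlocks D I (-Iᵀ) 0 * fromBlocks P (-(D' * I * L⁻¹)) (L⁻¹ * Iᵀ * D') L⁻¹ = 1 := by
    rw [fromBlocks_multiply, ← fromBlocks_one]
    congr 1
    · rw [hP', Matrix.mul_sub, hDD']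
      simp only [← Matrix.mul_assoc, hDD', Matrix.one_mul, sub_add_cancel]
    · simp only [Matrix.mul_neg, ← Matrix.mul_assoc, hDD', Matrix.one_mul, neg_add_cancel]
    · rw [hP', Matrix.mul_sub]
      simp only [← Matrix.mul_assoc, Matrix.neg_mul, hLI, Matrix.one_mul, Matrix.zero_mul,
        sub_self, add_zero]
    · simp only [← Matrix.mul_assoc, Matrix.neg_mul, Matrix.mul_neg, neg_neg, hLI,
        Matrix.zero_mul, add_zero]
  have h2 : MM m n' s t a *
      (fromBlocks P (-(D' * I * L⁻¹)) (L⁻¹ * Iᵀ * D') L⁻¹).submatrix finSumFinEquiv.symm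
        finSumFinEquiv.symm = 1 := by
    change (fromBlocks D I (-Iᵀ) 0).submatrix finSumFinEquiv.symm finSumFinEquiv.symm * _ = 1
    rw [submatrix_mul_equiv, h1, submatrix_one_equiv]
  have h3 := Matrix.inv_eq_right_inv h2
  rw [← hPsymm, transpose_apply, ← adjugate_MM_edge]
  have h4 := congrFun (congrFun h3 (edgeIdx m n' f)) (edgeIdx m n' e)
  rw [Matrix.inv_def, Ring.inverse_eq_inv', Matrix.smul_apply, smul_eq_mul] at h4
  simp only [edgeIdx, submatrix_apply, finSumFinEquiv_symm_apply_castAdd,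
    fromBlocks_apply₁₁] at h4
  rw [← h4, mul_comm]
  rfl

theorem det_cycle_rows_eq_zero {m n' ℓ : ℕ} {s t : Fin m → Fin (n' + 1)}
    (hconn : IsConnectedGraph m (n' + 1) s t) (hm : ℓ + n' = m)
    {C : Matrix (Fin m) (Fin ℓ) ℤ} (hC : IsCycleMatrix m n' ℓ s t C) {g : Fin ℓ → Fin m}
    (hg : Function.Injective g)
    (hT : ¬ IsSpanningTree m (n' + 1) s t (Finset.univ.image g)ᶜ) :
    (C.submatrix g id).det = 0 := by
  classical
  set T := (Finset.univ.image g)ᶜ with hTdef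
  have hcard : T.card = n' + 1 - 1 := by
    rw [hTdef, Finset.card_compl, Finset.card_image_of_injective _ hg]
    simp
    omega
  have hsymm {x y : Fin (n' + 1)} (h : Conn m (n' + 1) s t ↑T x y) :
      Conn m (n' + 1) s t ↑T y x :=
    (@Relation.ReflTransGen.stdSymm _ _ ⟨fun _ _ ⟨e, he, h⟩ => ⟨e, he, h.symm⟩⟩).symm _ _ h
  obtain ⟨x, hx⟩ : ∃ x, ¬ Conn m (n' + 1) s t ↑T (Fin.last n') x := by
    by_contra! h
    exact hT ⟨hcard, fun x y => (hsymm (h x)).trans (h y)⟩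
  let y : Fin n' → ℤ := fun j => if Conn m (n' + 1) s t ↑T j.castSucc x then 1 else 0
  have hy (v : Fin (n' + 1)) :
      extendZero y v = if Conn m (n' + 1) s t ↑T v x then 1 else 0 := by
    refine Fin.lastCases ?_ (fun i => ?_) v
    · simp [extendZero, hx]
    · simp [extendZero, y]
  set u := (inc ℤ m n' s t).mulVec y with hu
  have huT : ∀ e ∈ T, u e = 0 := by
    intro e he
    have hst : Conn m (n' + 1) s t ↑T (s e) (t e) := .single ⟨e, he, .inl ⟨rfl, rfl⟩⟩
    have : Conn m (n' + 1) s t ↑T (t e) x ↔ Conn m (n' + 1) s t ↑T (s e) x :=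
      ⟨fun h => hst.trans h, fun h => (hsymm hst).trans h⟩
    rw [hu, inc_mulVec, hy, hy, if_congr this rfl rfl, sub_self]
  refine Matrix.exists_vecMul_eq_zero_iff.1 ⟨u ∘ g, fun h => ?_, ?_⟩
  · have hu0 : u = 0 := by
      funext e
      by_cases he : e ∈ T
      · exact huT e he
      · obtain ⟨i, -, rfl⟩ : ∃ i ∈ Finset.univ, g i = e := by simpa [hTdef] using he
        exact congrFun h i
    have hy0 := inc_mulVec_eq_zero hconn hu0
    have h1 : extendZero y x = 1 := by
      rw [hy, if_pos]
      exact .refl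
    rw [hy0] at h1
    refine Fin.lastCases (fun h => ?_) (fun i h => ?_) x h1 <;> simp [extendZero] at h
  · have huC : u ᵥ* C = 0 := by
      rw [hu, ← Matrix.vecMul_transpose, Matrix.vecMul_vecMul, hC.1, vecMul_zero]
    funext j
    rw [← congrFun huC j]
    simp only [vecMul, dotProduct, Function.comp_apply, submatrix_apply, id]
    rw [← Finset.sum_image (f := fun e => u e * C e j) (hg.injOn)]
    refine Finset.sum_subset (Finset.subset_univ _) fun e _ he => ?_
    rw [huT e (by simpa [hTdef] using he), zero_mul]

theorem prod_ofFn_two_mul {M : Type*} [Monoid M] {k : ℕ} (f : Fin (2 * k) → M) :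
    (List.ofFn f).prod = (List.ofFn fun i : Fin k =>
      f ⟨2 * i.1, by have := i.2; omega⟩ * f ⟨2 * i.1 + 1, by have := i.2; omega⟩).prod := by
  rw [List.ofFn_mul', List.prod_flatten, List.map_ofFn]
  congr 2
  funext i
  simp [List.ofFn_succ]

theorem prod_univ_two_mul {M : Type*} [CommMonoid M] {k : ℕ} (f : Fin (2 * k) → M) :
    ∏ j, f j = ∏ i : Fin k,
      f ⟨2 * i.1, by have := i.2; omega⟩ * f ⟨2 * i.1 + 1, by have := i.2; omega⟩ := by
  simpa [List.prod_ofFn] using prod_ofFn_two_mul f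

/-- Functions on `Fin (2 * k)` as `k`-tuples of pairs of consecutive values. -/
def pairEquiv (k : ℕ) (α : Type*) : (Fin (2 * k) → α) ≃ (Fin k → α × α) where
  toFun g i := (g ⟨2 * i.1, by have := i.2; omega⟩, g ⟨2 * i.1 + 1, by have := i.2; omega⟩)
  invFun r j := if j.1 % 2 = 0 then (r ⟨j.1 / 2, by have := j.2; omega⟩).1
    else (r ⟨j.1 / 2, by have := j.2; omega⟩).2
  left_inv g := by
    funext j
    by_cases h : j.1 % 2 = 0
    · simp only [h, if_true]
      congr 1
      ext
      simp only
      omega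
    · simp only [h, if_false]
      congr 1
      ext
      simp only
      omega
  right_inv r := by
    funext i
    have h1 : (2 * i.1 + 1) % 2 ≠ 0 := by omega
    have h2 : (2 * i.1 + 1) / 2 = i.1 := by omega
    simp [h2]

theorem prod_ofFn_sum_smul {A ι : Type*} [Ring A] [Algebra ℝ A] [Fintype ι] {k : ℕ}
    (c : Fin k → ι → ℝ) (x : ι → A) :
    (List.ofFn fun i => ∑ p, c i p • x p).prod =
      ∑ r : Fin k → ι, (∏ i, c i (r i)) • (List.ofFn fun i => x (r i)).prod := by
  classical
  simp only [← MultilinearMap.mkPiAlgebraFin_apply (R := ℝ), MultilinearMap.map_sum,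
    MultilinearMap.map_smul_univ]

theorem pfaffian_eq_sum_functions {m k : ℕ} (B : Matrix (Fin m) (Fin (2 * k)) ℝ)
    (P : Matrix (Fin m) (Fin m) ℝ)
    (X : Matrix (Fin (2 * k)) (Fin (2 * k)) (ExteriorAlgebra ℝ (Fin m → ℝ)))
    (hX : ∀ i j, X i j = ∑ p : Fin m × Fin m,
      (B p.1 i * P p.1 p.2 * B p.2 j) • (θ m p.1 * θ m p.2)) :
    pfaffian rfl X = (2 ^ k * (Nat.factorial k : ℝ))⁻¹ •
      ∑ g : Fin (2 * k) → Fin m, ((B.submatrix g id).det * ∏ i : Fin k,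
        P (g ⟨2 * i.1, by have := i.2; omega⟩) (g ⟨2 * i.1 + 1, by have := i.2; omega⟩)) •
          (List.ofFn fun j => θ m (g j)).prod := by
  have hdet (g : Fin (2 * k) → Fin m) : (B.submatrix g id).det =
      ∑ σ : Equiv.Perm (Fin (2 * k)), ((Equiv.Perm.sign σ : ℤ) : ℝ) * ∏ j, B (g j) (σ j) := by
    rw [← det_transpose, det_apply']
    rfl
  rw [pfaffian]
  congr 1
  simp only [hdet, Finset.sum_mul, Finset.sum_smul]
  rw [Finset.sum_comm]
  refine Finset.sum_congr rfl fun σ _ => ?_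
  simp only [hX, Fin.cast_mk]
  rw [prod_ofFn_sum_smul (fun (i : Fin k) (p : Fin m × Fin m) => _)
    (fun p : Fin m × Fin m => θ m p.1 * θ m p.2), Finset.smul_sum,
    ← Equiv.sum_comp (pairEquiv k (Fin m))]
  refine Finset.sum_congr rfl fun g _ => ?_
  rw [smul_smul, prod_univ_two_mul fun j => B (g j) (σ j), prod_ofFn_two_mul, mul_assoc,
    ← Finset.prod_mul_distrib]
  simp only [pairEquiv, Equiv.coe_fn_mk]
  congr 2
  refine Finset.prod_congr rfl fun i _ => ?_
  ring

theorem dLam_mul_map_mul_dLam_apply {m ℓ : ℕ} (C : Matrix (Fin m) (Fin ℓ) ℤ)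
    (Q : Matrix (Fin ℓ) (Fin ℓ) ℝ) (i j : Fin ℓ) :
    (dLam C * Q.map (algebraMap ℝ (ExteriorAlgebra ℝ (Fin m → ℝ))) * dLam C) i j =
      ∑ p : Fin m × Fin m, (C.map (Int.cast : ℤ → ℝ) p.1 i *
        (C.map (Int.cast : ℤ → ℝ) * Q * (C.map (Int.cast : ℤ → ℝ))ᵀ) p.1 p.2 *
          C.map (Int.cast : ℤ → ℝ) p.2 j) • (θ m p.1 * θ m p.2) := by
  set B := C.map (Int.cast : ℤ → ℝ) with hB
  set φ := algebraMap ℝ (ExteriorAlgebra ℝ (Fin m → ℝ)) with hφ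
  have h1 : dLam C = (B.map φ)ᵀ * diagonal (θ m) * B.map φ := rfl
  have h2 : dLam C * Q.map φ * dLam C =
      (B.map φ)ᵀ * diagonal (θ m) * (B * Q * Bᵀ).map φ * (diagonal (θ m) * B.map φ) := by
    rw [h1, Matrix.map_mul, Matrix.map_mul, transpose_map]
    simp only [Matrix.mul_assoc]
  rw [h2, Matrix.mul_apply, Fintype.sum_prod_type, Finset.sum_comm]
  refine Finset.sum_congr rfl fun f _ => ?_
  rw [Matrix.mul_apply, Finset.sum_mul]
  refine Finset.sum_congr rfl fun e _ => ?_
  simp only [mul_diagonal, diagonal_mul, transpose_apply, map_apply]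
  rw [← Algebra.commutes (B f j) (θ m f), hφ]
  simp only [Algebra.algebraMap_eq_smul_one, smul_mul_assoc, mul_smul_comm, one_mul, mul_one,
    smul_smul]
  congr 1
  ring

theorem prod_ofFn_θ_eq_zero {m ℓ : ℕ} {g : Fin ℓ → Fin m} (hg : ¬ Function.Injective g) :
    (List.ofFn fun j => θ m (g j)).prod = 0 := by
  refine (ExteriorAlgebra.ιMulti ℝ ℓ).map_eq_zero_of_not_injective
    (fun j => (Pi.single (g j) 1 : Fin m → ℝ)) fun h => hg fun i j hij => h ?_
  simp only [hij]

theorem prod_ofFn_θ_comp_perm {m ℓ : ℕ} (f : Fin ℓ → Fin m) (τ : Equiv.Perm (Fin ℓ)) :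
    (List.ofFn fun j => θ m (f (τ j))).prod =
      ((Equiv.Perm.sign τ : ℤ) : ℝ) • (List.ofFn fun j => θ m (f j)).prod := by
  have := (ExteriorAlgebra.ιMulti ℝ ℓ).map_perm (fun j => (Pi.single (f j) 1 : Fin m → ℝ)) τ
  rw [Units.smul_def, ← Int.cast_smul_eq_zsmul ℝ] at this
  exact this

/-- Functions with image `S` are the reorderings of the increasing enumeration of `S`. -/
theorem sum_image_eq {m ℓ : ℕ} {β : Type*} [AddCommMonoid β] (S : Finset (Fin m))
    (h : S.card = ℓ) (F : (Fin ℓ → Fin m) → β) :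
    ∑ g ∈ Finset.univ.filter (fun g : Fin ℓ → Fin m => Finset.univ.image g = S), F g =
      ∑ τ : Equiv.Perm (Fin ℓ), F fun j => (S.orderIsoOfFin h (τ j) : Fin m) := by
  symm
  refine Finset.sum_bij (fun τ _ j => (S.orderIsoOfFin h (τ j) : Fin m)) ?_ ?_ ?_ fun _ _ => rfl
  · intro τ _
    simp only [Finset.mem_filter, Finset.mem_univ, true_and]
    ext e
    simp only [Finset.mem_image, Finset.mem_univ, true_and]
    constructor
    · rintro ⟨j, rfl⟩
      exact (S.orderIsoOfFin h (τ j)).2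
    · intro he
      exact ⟨τ.symm ((S.orderIsoOfFin h).symm ⟨e, he⟩), by simp⟩
  · intro τ _ τ' _ hττ'
    ext j : 1
    exact (S.orderIsoOfFin h).injective (Subtype.ext (congrFun hττ' j))
  · intro g hg
    simp only [Finset.mem_filter, Finset.mem_univ, true_and] at hg
    have hmem (j : Fin ℓ) : g j ∈ S := hg ▸ Finset.mem_image_of_mem g (Finset.mem_univ j)
    have hsurj : Function.Surjective fun j => (S.orderIsoOfFin h).symm ⟨g j, hmem j⟩ := by
      intro i
      have : (S.orderIsoOfFin h i : Fin m) ∈ Finset.univ.image g := hg ▸ (S.orderIsoOfFin h i).2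
      obtain ⟨j, -, hj⟩ := Finset.mem_image.1 this
      exact ⟨j, (OrderIso.symm_apply_eq _).2 (Subtype.ext hj)⟩
    refine ⟨Equiv.ofBijective _ (Finite.surjective_iff_bijective.1 hsurj), Finset.mem_univ _, ?_⟩
    funext j
    simp

theorem pfaffian_coefficient {ψ : ℝ} (hψ : 0 < ψ) (k : ℕ) :
    ((((-2) * Real.pi) ^ k)⁻¹ * (Real.sqrt ψ)⁻¹) * (2 ^ k * (Nat.factorial k : ℝ))⁻¹ * ψ⁻¹ ^ k =
      ((-Real.pi) ^ k * 2 ^ (2 * k) * (Nat.factorial k : ℝ) *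
          ψ ^ ((((2 * k : ℕ) : ℝ) + 1) / 2))⁻¹ := by
  have h1 : ψ ^ ((((2 * k : ℕ) : ℝ) + 1) / 2) = ψ ^ k * Real.sqrt ψ := by
    rw [Real.sqrt_eq_rpow, ← Real.rpow_natCast, ← Real.rpow_add hψ]
    congr 1
    push_cast
    ring
  have h2 : ((-2) * Real.pi) ^ k = (-Real.pi) ^ k * 2 ^ k := by
    rw [← mul_pow]
    congr 1
    ring
  rw [h1, h2, inv_pow, ← mul_inv, ← mul_inv, ← mul_inv]
  congr 1
  ring

/-- The sum over the reorderings of the increasing enumeration of `S`. -/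
theorem sum_perm_eq {m n' k : ℕ} {s t : Fin m → Fin (n' + 1)}
    (a : Fin m → ℝ) (C : Matrix (Fin m) (Fin (2 * k)) ℤ)
    {P : Matrix (Fin m) (Fin m) ℝ} {c : ℝ}
    (hP : ∀ e f, P e f = (-1) ^ ((e : ℕ) + f) * dodgE m n' s t a e f * c)
    (S : Finset (Fin m)) (h : S.card = 2 * k) :
    ∑ τ : Equiv.Perm (Fin (2 * k)),
      ((((C.map (Int.cast : ℤ → ℝ)).submatrix
          (fun j => (S.orderIsoOfFin h (τ j) : Fin m)) id).det * ∏ i : Fin k,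
        P (S.orderIsoOfFin h (τ ⟨2 * i.1, by have := i.2; omega⟩))
          (S.orderIsoOfFin h (τ ⟨2 * i.1 + 1, by have := i.2; omega⟩))) •
        (List.ofFn fun j => θ m (S.orderIsoOfFin h (τ j))).prod) =
      c ^ k • (((-1 : ℝ) ^ (∑ e ∈ S, ((e : ℕ) + 1)) * ((rowSub C S (2 * k)).det : ℝ) *
        ∑ τ : Equiv.Perm (Fin (2 * k)), ∏ i : Fin k, dodgE m n' s t a
          (S.orderIsoOfFin h (τ ⟨2 * i.1, by have := i.2; omega⟩))
          (S.orderIsoOfFin h (τ ⟨2 * i.1 + 1, by have := i.2; omega⟩))) •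
        (List.ofFn fun j => θ m (S.orderIsoOfFin h j)).prod) := by
  set f : Fin (2 * k) → Fin m := fun j => (S.orderIsoOfFin h j : Fin m) with hf
  have hdet (τ : Equiv.Perm (Fin (2 * k))) :
      ((C.map (Int.cast : ℤ → ℝ)).submatrix (fun j => f (τ j)) id).det =
        ((Equiv.Perm.sign τ : ℤ) : ℝ) * ((rowSub C S (2 * k)).det : ℝ) := by
    have h1 : (C.map (Int.cast : ℤ → ℝ)).submatrix (fun j => f (τ j)) id =
        ((Int.castRingHom ℝ).mapMatrix (rowSub C S (2 * k))).submatrix τ id := by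
      rw [rowSub, dif_pos h]
      rfl
    rw [h1, det_permute, ← RingHom.map_det]
    rfl
  have hsign (τ : Equiv.Perm (Fin (2 * k))) :
      ∏ i : Fin k, ((-1 : ℝ) ^ ((f (τ ⟨2 * i.1, by have := i.2; omega⟩) : ℕ) +
        f (τ ⟨2 * i.1 + 1, by have := i.2; omega⟩))) = (-1) ^ (∑ e ∈ S, ((e : ℕ) + 1)) := by
    have hprod : ∏ j, (-1 : ℝ) ^ ((f (τ j) : ℕ) + 1) = ∏ e ∈ S, (-1 : ℝ) ^ ((e : ℕ) + 1) := by
      rw [← Finset.prod_coe_sort S, Equiv.prod_comp τ fun j => (-1 : ℝ) ^ ((f j : ℕ) + 1)]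
      exact Equiv.prod_comp (S.orderIsoOfFin h).toEquiv fun e : S => (-1 : ℝ) ^ ((e : ℕ) + 1)
    rw [← Finset.prod_pow_eq_pow_sum, ← hprod, prod_univ_two_mul]
    refine Finset.prod_congr rfl fun i _ => ?_
    ring
  change ∑ τ : Equiv.Perm (Fin (2 * k)),
      ((((C.map (Int.cast : ℤ → ℝ)).submatrix (fun j => f (τ j)) id).det * ∏ i : Fin k,
        P (f (τ ⟨2 * i.1, by have := i.2; omega⟩))
          (f (τ ⟨2 * i.1 + 1, by have := i.2; omega⟩))) •
        (List.ofFn fun j => θ m (f (τ j))).prod) = _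
  rw [smul_smul, Finset.mul_sum, Finset.mul_sum, Finset.sum_smul]
  refine Finset.sum_congr rfl fun τ _ => ?_
  rw [prod_ofFn_θ_comp_perm f τ, smul_smul, hdet]
  congr 1
  simp only [hP, Finset.prod_mul_distrib, hsign, Finset.prod_const, Finset.card_univ,
    Fintype.card_fin]
  have hs : ((Equiv.Perm.sign τ : ℤ) : ℝ) * ((Equiv.Perm.sign τ : ℤ) : ℝ) = 1 := by
    rw [← Int.cast_mul, ← Units.val_mul, Int.units_mul_self]
    simp
  linear_combination (c ^ k * (-1) ^ (∑ e ∈ S, ((e : ℕ) + 1)) *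
    ((rowSub C S (2 * k)).det : ℝ) * ∏ i : Fin k, dodgE m n' s t a
      (f (τ ⟨2 * i.1, by have := i.2; omega⟩))
      (f (τ ⟨2 * i.1 + 1, by have := i.2; omega⟩))) * hs

/-- **Dodgson representation of the Pfaffian form.** -/
theorem pfaffian_form_dodgson (m n' ℓ k : ℕ) (s t : Fin m → Fin (n' + 1))
    (hconn : IsConnectedGraph m (n' + 1) s t)
    (hm : ℓ + n' = m) (hk : ℓ = 2 * k)
    (a : Fin m → ℝ) (ha : ∀ i, 0 < a i)
    (C : Matrix (Fin m) (Fin ℓ) ℤ) (hC : IsCycleMatrix m n' ℓ s t C) :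
    phiForm m n' ℓ k hk s t a C =
      (((-Real.pi) ^ k * 2 ^ ℓ * (Nat.factorial k : ℝ) *
          psi m n' s t a ^ (((ℓ : ℝ) + 1) / 2))⁻¹) •
        treeSum m n' s t (fun T =>
          if h : Tᶜ.card = ℓ then
            ((-1 : ℝ) ^ (∑ e ∈ Tᶜ, ((e : ℕ) + 1)) * ((rowSub C Tᶜ ℓ).det : ℝ) *
                ∑ σ : Equiv.Perm (Fin ℓ), ∏ i : Fin k,
                  dodgE m n' s t a
                    ((Tᶜ.orderIsoOfFin h)
                      (σ (Fin.cast hk.symm ⟨2 * i.1, by have := i.2; omega⟩)) : Fin m)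
                    ((Tᶜ.orderIsoOfFin h)
                      (σ (Fin.cast hk.symm ⟨2 * i.1 + 1, by have := i.2; omega⟩)) : Fin m)) •
              (List.ofFn fun j : Fin ℓ => θ m ((Tᶜ.orderIsoOfFin h) j : Fin m)).prod
          else 0) := by
  classical
  subst hk
  set F : (Fin (2 * k) → Fin m) → ExteriorAlgebra ℝ (Fin m → ℝ) := fun g =>
    (((C.map (Int.cast : ℤ → ℝ)).submatrix g id).det * ∏ i : Fin k,
      (C.map (Int.cast : ℤ → ℝ) * (cycleLap a C)⁻¹ * (C.map (Int.cast : ℤ → ℝ))ᵀ)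
        (g ⟨2 * i.1, by have := i.2; omega⟩) (g ⟨2 * i.1 + 1, by have := i.2; omega⟩)) •
      (List.ofFn fun j => θ m (g j)).prod with hF
  have hpf : pfaffian rfl (dLam C *
      ((cycleLap a C)⁻¹).map (algebraMap ℝ (ExteriorAlgebra ℝ (Fin m → ℝ))) * dLam C) =
      (2 ^ k * (Nat.factorial k : ℝ))⁻¹ • ∑ g, F g :=
    pfaffian_eq_sum_functions _ _ _ (dLam_mul_map_mul_dLam_apply C _)
  have hzero (g : Fin (2 * k) → Fin m)
      (hg : ¬ IsSpanningTree m (n' + 1) s t (Finset.univ.image g)ᶜ) : F g = 0 := by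
    by_cases hinj : Function.Injective g
    · have hdet : ((C.map (Int.cast : ℤ → ℝ)).submatrix g id).det = 0 := by
        have h := (Int.castRingHom ℝ).map_det (C.submatrix g id)
        rw [det_cycle_rows_eq_zero hconn hm hC hinj hg, map_zero] at h
        exact h.symm
      simp only [hF, hdet, zero_mul, zero_smul]
    · simp only [hF, prod_ofFn_θ_eq_zero hinj, smul_zero]
  have hsum : ∑ g, F g = treeSum m n' s t fun T =>
      ∑ g ∈ Finset.univ.filter (fun g : Fin (2 * k) → Fin m => Finset.univ.image g = Tᶜ), F g := by
    rw [treeSum, ← Finset.sum_fiberwise Finset.univ (fun g => (Finset.univ.image g)ᶜ) F,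
      Finset.sum_filter]
    refine Finset.sum_congr rfl fun T _ => ?_
    split_ifs with hT
    · simp only [compl_eq_comm (x := Finset.univ.image _), eq_comm (b := Tᶜ)]
    · refine Finset.sum_eq_zero fun g hg => hzero g ?_
      rwa [(Finset.mem_filter.1 hg).2]
  rw [phiForm, hpf, hsum, smul_smul, ← pfaffian_coefficient (psi_pos hconn ha) k,
    mul_smul _ ((psi m n' s t a)⁻¹ ^ k)]
  congr 1
  simp only [treeSum, Finset.smul_sum]
  refine Finset.sum_congr rfl fun T hT => ?_
  have hcard : Tᶜ.card = 2 * k := by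
    have := ((Finset.mem_filter.1 hT).2).1
    rw [Finset.card_compl, this, Fintype.card_fin]
    omega
  rw [dif_pos hcard, sum_image_eq _ hcard]
  exact sum_perm_eq a C (cycle_propagator_eq_dodgE hconn hm ha hC) _ hcard

end GraphForms
end

section
/- Sign lemma relating incidence and cycle minors. Let G be a connected graph, 𝒞 a cycle incidence matrix of G, and 𝒫 any m × (n−1) integer matrix with 𝒫ᵀ 𝕀 = 1_{n−1}. Then for every subset T ⊆ E with |T| = n − 1, writing E ∖ T = {f_1 < ... < f_ℓ} with f_i = e_{k_i}, one has det(𝕀[T]) = (−1)^{ℓ(ℓ+1)/2} det[𝒞|𝒫] · (−1)^{k_1+⋯+k_ℓ} det(𝒞[E∖T]). In particular the sign (−1)^{ℓ(ℓ+1)/2} det[𝒞|𝒫] is independent of T, and both sides of the equation are zero unless T is a spanning tree of G. -/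
open Matrix BigOperators

namespace GraphForms

/-- An edge set splits the indices below one of its elements into the smaller elements of the set
and the smaller elements of the complement. -/
theorem card_orderEmbOfFin_compl_lt {ℓ n m : ℕ} {S : Finset (Fin m)} (hS : S.card = ℓ)
    (hS' : Sᶜ.card = n) (i : Fin ℓ) :
    (Finset.univ.filter fun j => ¬ S.orderEmbOfFin hS i < Sᶜ.orderEmbOfFin hS' j).card + (i : ℕ) =
      S.orderEmbOfFin hS i := by
  have hne (j : Fin n) : S.orderEmbOfFin hS i ≠ Sᶜ.orderEmbOfFin hS' j := fun h =>
    Finset.mem_compl.1 (Sᶜ.orderEmbOfFin_mem hS' j) (h ▸ S.orderEmbOfFin_mem hS i)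
  have h : (∑ x : Fin m, if x < S.orderEmbOfFin hS i then 1 else 0) =
      (S.orderEmbOfFin hS i : ℕ) := by
    rw [← Finset.card_filter, Finset.filter_gt_eq_Iio, Fin.card_Iio]
  rw [← h, ← Equiv.sum_comp (finSumEquivOfFinset hS hS'), Fintype.sum_sum_type]
  simp only [finSumEquivOfFinset_inl, finSumEquivOfFinset_inr, OrderEmbedding.lt_iff_lt,
    ← Finset.card_filter]
  rw [add_comm]
  congr 1
  · rw [Finset.filter_gt_eq_Iio, Fin.card_Iio]
  · rw [Finset.card_filter]
    exact Finset.sum_congr rfl fun j _ =>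
      if_congr (not_lt.trans (hne j).symm.le_iff_lt) rfl rfl

/-- The sign of the shuffle listing first the elements of `S` and then those of `Sᶜ`. -/
theorem sign_finSumEquivOfFinset {ℓ n : ℕ} {S : Finset (Fin (ℓ + n))} (hS : S.card = ℓ)
    (hS' : Sᶜ.card = n) :
    (Equiv.Perm.sign (finSumFinEquiv.symm.trans (finSumEquivOfFinset hS hS')) : ℤ) =
      (-1) ^ (ℓ * (ℓ + 1) / 2) * (-1) ^ (∑ e ∈ S, ((e : ℕ) + 1)) := by
  have hsign : Equiv.Perm.sign (finSumFinEquiv.symm.trans (finSumEquivOfFinset hS hS')) =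
      ∏ i : Fin ℓ, (-1) ^
        (Finset.univ.filter fun j => ¬ S.orderEmbOfFin hS i < Sᶜ.orderEmbOfFin hS' j).card := by
    rw [Equiv.Perm.sign_eq_prod_prod_Ioi, Fin.prod_univ_add]
    simp only [← Finset.filter_lt_eq_Ioi, Finset.prod_filter, Fin.prod_univ_add,
      Equiv.trans_apply, finSumFinEquiv_symm_apply_castAdd, finSumFinEquiv_symm_apply_natAdd,
      finSumEquivOfFinset_inl, finSumEquivOfFinset_inr, OrderEmbedding.lt_iff_lt]
    have h₁ (i j : Fin ℓ) : (if Fin.castAdd n i < Fin.castAdd n j then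
        (if i < j then (1 : ℤˣ) else -1) else 1) = 1 := by
      grind [Fin.lt_def, Fin.val_castAdd]
    have h₂ (i j : Fin n) : (if Fin.natAdd ℓ i < Fin.natAdd ℓ j then
        (if i < j then (1 : ℤˣ) else -1) else 1) = 1 := by
      grind [Fin.lt_def, Fin.val_natAdd]
    have h₃ (i : Fin ℓ) (j : Fin n) : Fin.castAdd n i < Fin.natAdd ℓ j := by
      simp only [Fin.lt_def, Fin.val_castAdd, Fin.val_natAdd]
      omega
    simp only [h₁, h₂, h₃, (h₃ _ _).not_gt, if_true, if_false, Finset.prod_const_one, one_mul,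
      mul_one, Finset.prod_ite, Finset.prod_const]
  have hsum : ∑ e ∈ S, ((e : ℕ) + 1) = (∑ i : Fin ℓ,
      (Finset.univ.filter fun j => ¬ S.orderEmbOfFin hS i < Sᶜ.orderEmbOfFin hS' j).card) +
      ℓ * (ℓ + 1) / 2 := by
    have hgauss : ∑ i : Fin ℓ, ((i : ℕ) + 1) = ℓ * (ℓ + 1) / 2 := by
      rw [Fin.sum_univ_eq_sum_range (fun i => i + 1),
        ← (Finset.sum_range_succ' (fun i => i) ℓ).trans (add_zero _), Finset.sum_range_id,
        Nat.add_sub_cancel, mul_comm]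
    rw [← hgauss, ← Finset.sum_add_distrib, ← Finset.sum_coe_sort,
      ← Equiv.sum_comp (S.orderIsoOfFin hS).toEquiv]
    refine Finset.sum_congr rfl fun i _ => ?_
    rw [← add_assoc, card_orderEmbOfFin_compl_lt]
    rfl
  rw [hsign, Finset.prod_pow_eq_pow_sum, hsum, pow_add, mul_left_comm, ← pow_add, ← two_mul,
    pow_mul]
  simp

theorem rowSub_eq_submatrix {R : Type*} [Zero R] {m c k : ℕ} (X : Matrix (Fin m) (Fin c) R)
    {S : Finset (Fin m)} (h : S.card = k) :
    rowSub X S k = X.submatrix (S.orderEmbOfFin h) id := by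
  rw [rowSub, dif_pos h]
  rfl

theorem concat_eq_submatrix {R : Type*} {ℓ c : ℕ} (X : Matrix (Fin (ℓ + c)) (Fin ℓ) R)
    (Y : Matrix (Fin (ℓ + c)) (Fin c) R) :
    concat rfl X Y = (fromCols X Y).submatrix id finSumFinEquiv.symm := by
  ext i j
  simp only [concat, of_apply, submatrix_apply, id, Fin.cast_eq_self]
  cases finSumFinEquiv.symm j <;> rfl

/-- If the columns of `X` are annihilated by `Aᵀ` and `Y` is a right inverse of `Aᵀ`, then the
complementary minors of `A` and `X` are proportional, with factor `det [X|Y]` up to sign. -/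
theorem det_concat_mul_det_rowSub_compl {R : Type*} [CommRing R] {ℓ n : ℕ}
    {A Y : Matrix (Fin (ℓ + n)) (Fin n) R} {X : Matrix (Fin (ℓ + n)) (Fin ℓ) R}
    (hX : Aᵀ * X = 0) (hY : Aᵀ * Y = 1) {S : Finset (Fin (ℓ + n))} (hS : S.card = ℓ)
    (hS' : Sᶜ.card = n) :
    (Equiv.Perm.sign (finSumFinEquiv.symm.trans (finSumEquivOfFinset hS hS')) : ℤ) *
      (concat rfl X Y).det * (rowSub A Sᶜ n).det = (rowSub X S ℓ).det := by
  set e := finSumEquivOfFinset hS hS' with he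
  set B : Matrix (Fin ℓ ⊕ Fin n) (Fin (ℓ + n)) R :=
    fromRows ((1 : Matrix _ _ R).submatrix (S.orderEmbOfFin hS) id) Aᵀ with hB
  have hBe : (B.submatrix id e).det = (rowSub A Sᶜ n).det := by
    have : B.submatrix id e = fromBlocks 1 0 (rowSub A S ℓ)ᵀ (rowSub A Sᶜ n)ᵀ := by
      rw [rowSub_eq_submatrix A hS, rowSub_eq_submatrix A hS']
      ext (i | i) (j | j)
      · simp [hB, he, one_apply]
      · have hne : S.orderEmbOfFin hS i ≠ Sᶜ.orderEmbOfFin hS' j := fun h =>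
          Finset.mem_compl.1 (Sᶜ.orderEmbOfFin_mem hS' j) (h ▸ S.orderEmbOfFin_mem hS i)
        simp [hB, he, one_apply, hne]
      · simp [hB, he]
      · simp [hB, he]
    rw [this, det_fromBlocks_zero₁₂, det_one, one_mul, det_transpose]
  have hM : ((fromCols X Y).submatrix e id).det =
      (Equiv.Perm.sign (finSumFinEquiv.symm.trans e) : ℤ) * (concat rfl X Y).det := by
    rw [← det_permute, concat_eq_submatrix, ← det_submatrix_equiv_self finSumFinEquiv.symm]
    rfl
  have hmul : B.submatrix id e * (fromCols X Y).submatrix e id =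
      fromBlocks (rowSub X S ℓ) (rowSub Y S ℓ) 0 1 := by
    rw [submatrix_mul_equiv, submatrix_id_id, hB, fromRows_mul_fromCols, hX, hY,
      rowSub_eq_submatrix X hS, rowSub_eq_submatrix Y hS]
    have hsel {c : ℕ} (Z : Matrix (Fin (ℓ + n)) (Fin c) R) :
        (1 : Matrix (Fin (ℓ + n)) (Fin (ℓ + n)) R).submatrix (S.orderEmbOfFin hS) id * Z =
          Z.submatrix (S.orderEmbOfFin hS) id := by
      ext
      simp [mul_apply, one_apply]
    rw [hsel, hsel]
  rw [← hM, ← hBe, mul_comm, ← det_mul, hmul, det_fromBlocks_zero₂₁, det_one, mul_one]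

theorem IsCycleMatrix.isUnit_det_concat {n ℓ : ℕ} {s t : Fin (ℓ + n) → Fin (n + 1)}
    {C : Matrix (Fin (ℓ + n)) (Fin ℓ) ℤ} (hC : IsCycleMatrix (ℓ + n) n ℓ s t C)
    {P : Matrix (Fin (ℓ + n)) (Fin n) ℤ} (hP : (inc ℤ (ℓ + n) n s t)ᵀ * P = 1) :
    IsUnit (concat rfl C P).det := by
  rw [← isUnit_iff_isUnit_det, ← mulVec_surjective_iff_isUnit]
  intro x
  obtain ⟨c, hc, -⟩ := hC.2 (x - P *ᵥ ((inc ℤ (ℓ + n) n s t)ᵀ *ᵥ x)) (by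
    rw [mulVec_sub, mulVec_mulVec, hP, one_mulVec, sub_self])
  refine ⟨Sum.elim c ((inc ℤ (ℓ + n) n s t)ᵀ *ᵥ x) ∘ finSumFinEquiv.symm, ?_⟩
  rw [concat_eq_submatrix, submatrix_mulVec_equiv, Equiv.symm_symm, Function.comp_assoc,
    Equiv.symm_comp_self, Function.comp_id, Function.comp_id, fromCols_mulVec_sumElim, hc,
    sub_add_cancel]

theorem Conn.symm {m n : ℕ} {s t : Fin m → Fin n} {T : Set (Fin m)} {x y : Fin n}
    (h : Conn m n s t T x y) : Conn m n s t T y x :=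
  have : Std.Symm fun a b => ∃ e ∈ T, (s e = a ∧ t e = b) ∨ (s e = b ∧ t e = a) :=
    ⟨fun _ _ ⟨e, he, h⟩ => ⟨e, he, h.symm⟩⟩
  Relation.ReflTransGen.stdSymm.symm _ _ h

/-- The incidence minor of an edge set which does not connect all vertices vanishes: the indicator
of the vertices not connected to the distinguished one is in the kernel. -/
theorem det_rowSub_inc_eq_zero {m n : ℕ} {s t : Fin m → Fin (n + 1)} {T : Finset (Fin m)}
    (hT : T.card = n) (h : ¬ IsSpanningTree m (n + 1) s t T) :
    (rowSub (inc ℤ m n s t) T n).det = 0 := by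
  classical
  obtain ⟨v, hv⟩ : ∃ v, ¬ Conn m (n + 1) s t T v (Fin.last n) := by
    by_contra! hall
    exact h ⟨hT, fun x y => (hall x).trans (hall y).symm⟩
  let φ : Fin (n + 1) → ℤ := fun x => if Conn m (n + 1) s t T x (Fin.last n) then 0 else 1
  have hlast : φ (Fin.last n) = 0 := if_pos Relation.ReflTransGen.refl
  have hsum (x : Fin (n + 1)) :
      (∑ j : Fin n, if x = j.castSucc then φ j.castSucc else 0) = φ x := by
    have := Fin.sum_univ_castSucc fun y => if x = y then φ y else 0
    simpa [hlast] using this.symm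
  rw [← exists_mulVec_eq_zero_iff, rowSub_eq_submatrix _ hT]
  refine ⟨fun j => φ j.castSucc, fun h0 => ?_, ?_⟩
  · induction v using Fin.lastCases with
    | last => exact hv Relation.ReflTransGen.refl
    | cast j => simpa [φ, hv] using congrFun h0 j
  · ext i
    have he := T.orderEmbOfFin_mem hT i
    set e := T.orderEmbOfFin hT i with hedef
    have hst : φ (t e) = φ (s e) := by
      have hts : Conn m (n + 1) s t T (t e) (s e) := .single ⟨e, he, .inr ⟨rfl, rfl⟩⟩
      have : Conn m (n + 1) s t T (t e) (Fin.last n) ↔ Conn m (n + 1) s t T (s e) (Fin.last n) :=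
        ⟨hts.symm.trans, hts.trans⟩
      simp [φ, this]
    simp only [mulVec, dotProduct, submatrix_apply, inc, of_apply, id, ← hedef, sub_mul, ite_mul,
      one_mul, zero_mul, Finset.sum_sub_distrib, hsum, hst, sub_self, Pi.zero_apply]

/-- **Sign lemma relating incidence and cycle minors.** -/
theorem sign_lemma (m n' ℓ : ℕ) (s t : Fin m → Fin (n' + 1))
    (hconn : IsConnectedGraph m (n' + 1) s t) (hm : ℓ + n' = m)
    (C : Matrix (Fin m) (Fin ℓ) ℤ) (hC : IsCycleMatrix m n' ℓ s t C)
    (P : Matrix (Fin m) (Fin n') ℤ) (hP : Pᵀ * inc ℤ m n' s t = 1)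
    (T : Finset (Fin m)) (hT : T.card = n') :
    (rowSub (inc ℤ m n' s t) T n').det =
      (-1 : ℤ) ^ (ℓ * (ℓ + 1) / 2) * (concat hm C P).det *
        ((-1 : ℤ) ^ (∑ e ∈ Tᶜ, ((e : ℕ) + 1)) * (rowSub C Tᶜ ℓ).det) ∧
    (¬ IsSpanningTree m (n' + 1) s t T →
      (rowSub (inc ℤ m n' s t) T n').det = 0 ∧ (rowSub C Tᶜ ℓ).det = 0) := by
  subst hm
  have hP' : (inc ℤ (ℓ + n') n' s t)ᵀ * P = 1 := by
    rw [← transpose_inj, transpose_mul, transpose_transpose, hP, transpose_one]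
  have hS : Tᶜ.card = ℓ := by
    rw [Finset.card_compl, hT, Fintype.card_fin, Nat.add_sub_cancel]
  have hS' : Tᶜᶜ.card = n' := by rwa [compl_compl]
  have hdet := det_concat_mul_det_rowSub_compl hC.1 hP' hS hS'
  rw [Int.cast_id, sign_finSumEquivOfFinset, compl_compl] at hdet
  have hsq := Int.isUnit_mul_self (hC.isUnit_det_concat hP')
  have hpow (k : ℕ) : (-1 : ℤ) ^ k * (-1) ^ k = 1 := by simp [← mul_pow]
  have hmain : (rowSub (inc ℤ (ℓ + n') n' s t) T n').det =
      (-1 : ℤ) ^ (ℓ * (ℓ + 1) / 2) * (concat rfl C P).det *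
        ((-1 : ℤ) ^ (∑ e ∈ Tᶜ, ((e : ℕ) + 1)) * (rowSub C Tᶜ ℓ).det) := by
    grind
  refine ⟨hmain, fun h => ?_⟩
  have h0 := det_rowSub_inc_eq_zero hT h
  exact ⟨h0, by rw [← hdet, h0, mul_zero]⟩
end GraphForms
end

section
/- Determinant of the cycle Laplacian equals the Symanzik polynomial. Let G be a connected graph and 𝒞 a cycle incidence matrix of G. Then det(𝒞ᵀ D 𝒞) = ∑_{T spanning tree} ∏_{e_i ∉ T} a_i. In particular det Λ is the same for every choice of cycle incidence matrix 𝒞. -/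
open Matrix BigOperators

namespace GraphForms

/-- An averaged form of the Cauchy–Binet formula for `Xᵀ D X`. -/
theorem factorial_mul_det_transpose_mul_diagonal_mul {R m n : Type*} [CommRing R]
    [Fintype m] [DecidableEq m] [Fintype n] [DecidableEq n] (a : m → R) (X : Matrix m n R) :
    ((Fintype.card n).factorial : R) * (Xᵀ * diagonal a * X).det =
      ∑ f : n → m, (∏ i, a (f i)) * (X.submatrix f id).det ^ 2 := by
  have expand : (Xᵀ * diagonal a * X).det =
      ∑ f : n → m, (∏ i, a (f i)) * (∏ i, X (f i) i) * (X.submatrix f id).det := by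
    simp only [det_apply', mul_apply (M := Xᵀ * diagonal a), mul_diagonal, transpose_apply, Finset.prod_univ_sum,
      Finset.mul_sum, Fintype.piFinset_univ, submatrix_apply, id]
    rw [Finset.sum_comm]
    refine Finset.sum_congr rfl fun f _ => ?_
    have h : ∀ σ : Equiv.Perm n, ∏ i, X (f i) (σ i) = ∏ i, X (f (σ⁻¹ i)) i := fun σ => by
      rw [← Equiv.prod_comp σ fun i => X (f (σ⁻¹ i)) i]
      simp
    rw [← Equiv.sum_comp (Equiv.inv (Equiv.Perm n))]
    refine Finset.sum_congr rfl fun σ _ => ?_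
    simp only [Equiv.inv_apply, Finset.prod_mul_distrib, h, inv_inv, Equiv.Perm.sign_inv]
    ring
  have twist (σ : Equiv.Perm n) : (Xᵀ * diagonal a * X).det =
      ∑ f : n → m, (∏ i, a (f i)) * (X.submatrix f id).det *
        ((Equiv.Perm.sign σ : ℤ) * ∏ i, X (f (σ i)) i) := by
    rw [expand, ← Equiv.sum_comp (σ.symm.arrowCongr (Equiv.refl m))]
    refine Finset.sum_congr rfl fun f _ => ?_
    have hdet : (X.submatrix (f ∘ σ) id).det =
        (Equiv.Perm.sign σ : ℤ) * (X.submatrix f id).det :=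
      det_permute σ (X.submatrix f id)
    have hf : (σ.symm.arrowCongr (Equiv.refl m)) f = f ∘ σ := by
      ext i; simp
    rw [hf, hdet]
    simp only [Function.comp_apply, Equiv.prod_comp σ fun i => a (f i)]
    ring
  have hsum : ∑ _σ : Equiv.Perm n, (Xᵀ * diagonal a * X).det =
      ((Fintype.card n).factorial : R) * (Xᵀ * diagonal a * X).det := by
    simp [Fintype.card_perm]
  rw [← hsum, Finset.sum_congr rfl fun σ _ => twist σ, Finset.sum_comm]
  refine Finset.sum_congr rfl fun f _ => ?_
  rw [← Finset.mul_sum, sq, mul_assoc]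
  congr 2
  simp [det_apply']

/-- There are `k!` enumerations of a `k`-element set. -/
theorem card_filter_image_univ_eq {α : Type*} [Fintype α] [DecidableEq α] {k : ℕ}
    {S : Finset α} (hS : S.card = k) :
    (Finset.univ.filter fun f : Fin k → α => Finset.univ.image f = S).card = k.factorial := by
  have e : Fin k ≃ S := (Fintype.equivFinOfCardEq (by simpa using hS)).symm
  have hcard : Fintype.card (Fin k ≃ S) = k.factorial := by
    rw [Fintype.card_equiv e, Fintype.card_fin]
  rw [← hcard, ← Finset.card_univ]
  symm
  refine Finset.card_bij (fun g _ i => (g i : α)) ?_ ?_ ?_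
  · intro g _
    simp only [Finset.mem_filter, Finset.mem_univ, true_and]
    ext x
    simp only [Finset.mem_image, Finset.mem_univ, true_and]
    constructor
    · rintro ⟨i, rfl⟩
      exact (g i).2
    · intro hx
      exact ⟨g.symm ⟨x, hx⟩, by simp⟩
  · intro g _ g' _ h
    ext i
    exact congrFun h i
  · intro f hf
    simp only [Finset.mem_filter, Finset.mem_univ, true_and] at hf
    have hmem (i : Fin k) : f i ∈ S := hf ▸ Finset.mem_image_of_mem f (Finset.mem_univ i)
    have hbij : Function.Bijective fun i => (⟨f i, hmem i⟩ : S) := by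
      rw [Fintype.bijective_iff_surjective_and_card]
      refine ⟨?_, by simp [hS]⟩
      rintro ⟨x, hx⟩
      obtain ⟨i, -, hi⟩ := Finset.mem_image.1 (hf ▸ hx)
      exact ⟨i, Subtype.ext hi⟩
    exact ⟨Equiv.ofBijective _ hbij, Finset.mem_univ _, rfl⟩

/-- The basis vector of a vertex in the reduced vertex lattice; it vanishes at the distinguished
vertex. -/
def vertexVec {n' : ℕ} (v : Fin (n' + 1)) : Fin n' → ℤ :=
  fun j => if v = Fin.castSucc j then 1 else 0

theorem inc_transpose_mulVec_single {m n' : ℕ} (s t : Fin m → Fin (n' + 1)) (e : Fin m) :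
    (inc ℤ m n' s t)ᵀ.mulVec (Pi.single e 1) = vertexVec (t e) - vertexVec (s e) := by
  ext j
  simp [inc, vertexVec]

/-- A path inside `T` gives a chain supported on `T` whose boundary is the difference of the
endpoints. -/
theorem Conn.exists_chain {m n' : ℕ} {s t : Fin m → Fin (n' + 1)} {T : Set (Fin m)}
    {x y : Fin (n' + 1)} (h : Conn m (n' + 1) s t T x y) :
    ∃ z : Fin m → ℤ, (∀ e ∉ T, z e = 0) ∧
      (inc ℤ m n' s t)ᵀ.mulVec z = vertexVec y - vertexVec x := by
  induction h with
  | refl => exact ⟨0, by simp, by simp⟩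
  | tail _ hstep ih =>
    obtain ⟨z, hz, hz'⟩ := ih
    obtain ⟨e, he, hst⟩ := hstep
    have hsupp (e' : Fin m) (he' : e' ∉ T) : (Pi.single e 1 : Fin m → ℤ) e' = 0 :=
      Pi.single_eq_of_ne (by rintro rfl; exact he' he) 1
    rcases hst with ⟨rfl, rfl⟩ | ⟨rfl, rfl⟩
    · refine ⟨z + Pi.single e 1, fun e' he' => by simp [hz e' he', hsupp e' he'], ?_⟩
      rw [mulVec_add, hz', inc_transpose_mulVec_single]
      abel
    · refine ⟨z - Pi.single e 1, fun e' he' => by simp [hz e' he', hsupp e' he'], ?_⟩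
      rw [mulVec_sub, hz', inc_transpose_mulVec_single]
      abel

/-- If `T` connects all vertices, every reduced vertex vector is the boundary of a chain supported
on `T`. -/
theorem exists_chain_of_conn {m n' : ℕ} {s t : Fin m → Fin (n' + 1)} {T : Set (Fin m)}
    (h : ∀ x y, Conn m (n' + 1) s t T x y) (w : Fin n' → ℤ) :
    ∃ z : Fin m → ℤ, (∀ e ∉ T, z e = 0) ∧ (inc ℤ m n' s t)ᵀ.mulVec z = w := by
  choose z hz hz' using fun j : Fin n' => (h (Fin.last n') (Fin.castSucc j)).exists_chain
  refine ⟨∑ j, w j • z j, fun e he => by simp [hz _ e he], ?_⟩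
  rw [mulVec_sum]
  simp only [mulVec_smul, hz']
  ext i
  simp [vertexVec, (Fin.castSucc_ne_last _).symm, eq_comm]

/-- If `T` has as many edges as there are reduced vertices and is not connected, it supports a
nonzero cycle. -/
theorem exists_cycle_of_not_conn {m n' : ℕ} {s t : Fin m → Fin (n' + 1)} {T : Finset (Fin m)}
    (hT : T.card = n') (h : ¬ ∀ x y, Conn m (n' + 1) s t ↑T x y) :
    ∃ x : Fin m → ℤ, x ≠ 0 ∧ (∀ e ∉ T, x e = 0) ∧ (inc ℤ m n' s t)ᵀ.mulVec x = 0 := by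
  classical
  have hsymm {x y} (hxy : Conn m (n' + 1) s t ↑T x y) : Conn m (n' + 1) s t ↑T y x := by
    have hstep : Std.Symm fun a b : Fin (n' + 1) =>
        ∃ e ∈ (T : Set (Fin m)), (s e = a ∧ t e = b) ∨ (s e = b ∧ t e = a) :=
      ⟨fun _ _ ⟨e, he, hab⟩ => ⟨e, he, hab.symm⟩⟩
    exact Relation.ReflTransGen.stdSymm.symm _ _ hxy
  obtain ⟨v, hv⟩ : ∃ v, ¬ Conn m (n' + 1) s t ↑T (Fin.last n') v := by
    by_contra! hall
    exact h fun x y => (hsymm (hall x)).trans (hall y)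
  obtain ⟨j₀, rfl⟩ : ∃ j, Fin.castSucc j = v :=
    Fin.exists_castSucc_eq.2 fun hlast => hv (hlast ▸ Relation.ReflTransGen.refl)
  let p : Fin (n' + 1) → ℤ :=
    fun u => if Conn m (n' + 1) s t ↑T (Fin.last n') u then 0 else 1
  have hedge (e) (he : e ∈ T) : p (t e) = p (s e) := by
    have hiff : Conn m (n' + 1) s t ↑T (Fin.last n') (t e) ↔
        Conn m (n' + 1) s t ↑T (Fin.last n') (s e) :=
      ⟨fun hc => hc.tail ⟨e, he, Or.inr ⟨rfl, rfl⟩⟩, fun hc => hc.tail ⟨e, he, Or.inl ⟨rfl, rfl⟩⟩⟩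
    simp only [p, hiff]
  have hlast : p (Fin.last n') = 0 := if_pos Relation.ReflTransGen.refl
  have hsum (u : Fin (n' + 1)) :
      ∑ j : Fin n', (if u = Fin.castSucc j then (1 : ℤ) else 0) * p (Fin.castSucc j) = p u := by
    have := Fin.sum_univ_castSucc fun k : Fin (n' + 1) => (if u = k then (1 : ℤ) else 0) * p k
    rw [hlast, mul_zero, add_zero] at this
    rw [← this]
    simp
  let g : Fin n' ≃ T := (Fintype.equivFinOfCardEq (by simpa using hT)).symm
  let A : Matrix (Fin n') (Fin n') ℤ := (inc ℤ m n' s t).submatrix (fun i => (g i : Fin m)) id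
  have hA : A.det = 0 := by
    refine exists_mulVec_eq_zero_iff.1 ⟨fun j => p (Fin.castSucc j), ?_, ?_⟩
    · intro h0
      have := congrFun h0 j₀
      simp [p, hv] at this
    · ext i
      simp only [A, mulVec, dotProduct, submatrix_apply, id, inc, of_apply, sub_mul,
        Finset.sum_sub_distrib, hsum, Pi.zero_apply]
      rw [hedge _ (g i).2, sub_self]
  obtain ⟨y, hy0, hy⟩ := exists_mulVec_eq_zero_iff.2 ((det_transpose A).trans hA)
  refine ⟨fun e => if he : e ∈ T then y (g.symm ⟨e, he⟩) else 0, ?_, fun e he => dif_neg he, ?_⟩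
  · intro h0
    refine hy0 (funext fun i => ?_)
    simpa using congrFun h0 (g i)
  · ext j
    rw [← congrFun hy j]
    simp only [mulVec, dotProduct, transpose_apply]
    rw [← Finset.sum_subset (Finset.subset_univ T) fun e _ he => by simp [he],
      ← Finset.sum_coe_sort, ← Equiv.sum_comp g]
    simp [A]

/-- A maximal minor of a cycle matrix is `±1` if the remaining rows form a spanning tree, and `0`
otherwise. -/
theorem IsCycleMatrix.det_submatrix_sq {m n' ℓ : ℕ} {s t : Fin m → Fin (n' + 1)}
    {C : Matrix (Fin m) (Fin ℓ) ℤ} (hC : IsCycleMatrix m n' ℓ s t C) (hm : ℓ + n' = m)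
    (f : Fin ℓ → Fin m) [Decidable (IsSpanningTree m (n' + 1) s t (Finset.univ.image f)ᶜ)] :
    (C.submatrix f id).det ^ 2 =
      if IsSpanningTree m (n' + 1) s t (Finset.univ.image f)ᶜ then 1 else 0 := by
  set T := (Finset.univ.image f)ᶜ with hTdef
  have hmemT (e) : e ∉ T ↔ ∃ i, f i = e := by simp [hTdef]
  have hcard : T.card = n' ↔ Function.Injective f := by
    have h1 : (Finset.univ.image f).card ≤ ℓ := by
      simpa using Finset.card_image_le (s := Finset.univ) (f := f)
    have h2 : (Finset.univ.image f).card = ℓ ↔ Function.Injective f := by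
      simpa [Set.injOn_univ] using Finset.card_image_iff (s := Finset.univ) (f := f)
    rw [← h2, hTdef, Finset.card_compl, Fintype.card_fin]
    omega
  by_cases hf : Function.Injective f
  · by_cases hconn : ∀ x y, Conn m (n' + 1) s t ↑T x y
    · rw [if_pos ⟨by simpa using hcard.2 hf, hconn⟩]
      have hsurj : Function.Surjective (C.submatrix f id).mulVec := by
        intro y
        obtain ⟨z, hz, hz'⟩ := exists_chain_of_conn hconn
          (-(inc ℤ m n' s t)ᵀ.mulVec (Function.extend f y 0))
        obtain ⟨c, hc, -⟩ := hC.2 (Function.extend f y 0 + z) (by rw [mulVec_add, hz']; simp)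
        refine ⟨c, funext fun i => ?_⟩
        have := congrFun hc (f i)
        rw [Pi.add_apply, hf.extend_apply, hz (f i) (by simp [hTdef]), add_zero] at this
        exact this
      have hunit : IsUnit (C.submatrix f id) := mulVec_surjective_iff_isUnit.1 hsurj
      exact Int.isUnit_sq ((isUnit_iff_isUnit_det _).1 hunit)
    · rw [if_neg fun h => hconn h.2]
      obtain ⟨x, hx0, hx, hx'⟩ := exists_cycle_of_not_conn (hcard.2 hf) hconn
      obtain ⟨c, hc, -⟩ := hC.2 x hx'
      have hdet : (C.submatrix f id).det = 0 := by
        refine exists_mulVec_eq_zero_iff.1 ⟨c, ?_, funext fun i => ?_⟩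
        · rintro rfl
          exact hx0 (by rw [← hc, mulVec_zero])
        · exact (congrFun hc (f i)).trans (hx (f i) (by simp [hTdef]))
      rw [hdet, zero_pow two_ne_zero]
  · rw [if_neg fun h => hf (hcard.1 (by simpa using h.1))]
    obtain ⟨i, j, hij, hne⟩ : ∃ i j, f i = f j ∧ i ≠ j := by
      simpa [Function.Injective] using hf
    rw [det_zero_of_row_eq hne (by ext k; simp [hij]), zero_pow two_ne_zero]

theorem IsCycleMatrix.det_cycleLap {m n' ℓ : ℕ} {s t : Fin m → Fin (n' + 1)}
    {C : Matrix (Fin m) (Fin ℓ) ℤ} (hC : IsCycleMatrix m n' ℓ s t C) (hm : ℓ + n' = m)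
    (a : Fin m → ℝ) :
    (cycleLap a C).det = treeSum m n' s t (fun T => ∏ e ∈ Tᶜ, a e) := by
  classical
  have hfac : (ℓ.factorial : ℝ) ≠ 0 := Nat.cast_ne_zero.2 ℓ.factorial_ne_zero
  refine mul_left_cancel₀ hfac ?_
  have key := factorial_mul_det_transpose_mul_diagonal_mul a (C.map (Int.cast : ℤ → ℝ))
  rw [Fintype.card_fin] at key
  rw [cycleLap, key, treeSum, Finset.mul_sum]
  have hterm (f : Fin ℓ → Fin m) :
      (∏ i, a (f i)) * ((C.map (Int.cast : ℤ → ℝ)).submatrix f id).det ^ 2 =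
        if IsSpanningTree m (n' + 1) s t (Finset.univ.image f)ᶜ then ∏ i, a (f i) else 0 := by
    have hcast : ((C.map (Int.cast : ℤ → ℝ)).submatrix f id).det =
        (((C.submatrix f id).det : ℤ) : ℝ) :=
      ((Int.castRingHom ℝ).map_det (C.submatrix f id)).symm
    rw [hcast, ← Int.cast_pow, hC.det_submatrix_sq hm f]
    split_ifs <;> simp
  simp only [hterm]
  rw [← Finset.sum_filter, ← Finset.sum_fiberwise_of_maps_to
    (g := fun f : Fin ℓ → Fin m => (Finset.univ.image f)ᶜ)
    (t := Finset.univ.filter fun T => IsSpanningTree m (n' + 1) s t T) (by simp)]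
  refine Finset.sum_congr rfl fun T hT => ?_
  replace hT := (Finset.mem_filter.1 hT).2
  have hTc : Tᶜ.card = ℓ := by
    rw [Finset.card_compl, Fintype.card_fin, hT.1]
    omega
  have hfilter : ((Finset.univ.filter fun f : Fin ℓ → Fin m =>
      IsSpanningTree m (n' + 1) s t (Finset.univ.image f)ᶜ).filter
        fun f => (Finset.univ.image f)ᶜ = T) =
      Finset.univ.filter fun f : Fin ℓ → Fin m => Finset.univ.image f = Tᶜ := by
    ext f
    simp only [Finset.mem_filter, Finset.mem_univ, true_and, compl_eq_comm (y := T),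
      eq_comm (a := Tᶜ)]
    constructor
    · exact fun h => h.2
    · intro h
      exact ⟨by rwa [h, compl_compl], h⟩
  rw [hfilter, ← card_filter_image_univ_eq hTc, ← nsmul_eq_mul, ← Finset.sum_const]
  refine Finset.sum_congr rfl fun f hf => ?_
  replace hf := (Finset.mem_filter.1 hf).2
  have hinj : Set.InjOn f ↑(Finset.univ : Finset (Fin ℓ)) := by
    rw [← Finset.card_image_iff, hf, hTc, Finset.card_univ, Fintype.card_fin]
  rw [← hf, Finset.prod_image hinj]

/-- **det of the cycle Laplacian equals the Symanzik polynomial.** -/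
theorem det_cycleLap_eq_symanzik (m n' ℓ : ℕ) (s t : Fin m → Fin (n' + 1))
    (hconn : IsConnectedGraph m (n' + 1) s t) (hm : ℓ + n' = m)
    (a : Fin m → ℝ) (ha : ∀ i, 0 < a i)
    (C : Matrix (Fin m) (Fin ℓ) ℤ) (hC : IsCycleMatrix m n' ℓ s t C) :
    (cycleLap a C).det = treeSum m n' s t (fun T => ∏ e ∈ Tᶜ, a e) ∧
    ∀ C' : Matrix (Fin m) (Fin ℓ) ℤ, IsCycleMatrix m n' ℓ s t C' →
      (cycleLap a C').det = (cycleLap a C).det :=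
  ⟨hC.det_cycleLap hm a, fun _ hC' => (hC'.det_cycleLap hm a).trans (hC.det_cycleLap hm a).symm⟩
end GraphForms
end
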